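/- Let h : 𝔻 → 𝔻 be a holomorphic map from the open unit disk to itself that is symmetric (h(conj z) = conj(h z)), maps the real interval (-1,1) into [0,1), and satisfies h(0) ≤ l² for some l ∈ [0,1). Then for every k ∈ [0,1), h(k) ≤ ((k+l)/(1+k·l))². -/

import Mathlib

open Complex Metric Set

/-- The Möbius transformation of the unit disc, with real parameter `a`, sending `0` to `a`. -/
noncomputable def realMoebius (a : ℝ) (z : ℂ) : ℂ := (z + a) / (1 + a * z)

theorem one_add_ofReal_mul_ne_zero {a : ℝ} (ha : |a| < 1) {z : ℂ} (hz : ‖z‖ ≤ 1) :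
    1 + (a : ℂ) * z ≠ 0 := by
  intro h
  have h1 : (a : ℂ) * z = -1 := by linear_combination h
  have h2 : |a| * ‖z‖ = 1 := by simpa using congrArg norm h1
  nlinarith [norm_nonneg z, abs_nonneg a]

theorem differentiableAt_realMoebius {a : ℝ} (ha : |a| < 1) {z : ℂ} (hz : ‖z‖ ≤ 1) :
    DifferentiableAt ℂ (realMoebius a) z := by
  have := one_add_ofReal_mul_ne_zero ha hz
  unfold realMoebius
  fun_prop (disch := assumption)

theorem normSq_one_add_sub_normSq_add (a : ℝ) (z : ℂ) :
    ‖1 + (a : ℂ) * z‖ ^ 2 - ‖z + a‖ ^ 2 = (1 - a ^ 2) * (1 - ‖z‖ ^ 2) := by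
  simp only [← normSq_eq_norm_sq, normSq_apply, add_re, add_im, mul_re, mul_im, ofReal_re,
    ofReal_im, one_re, one_im]
  ring

theorem norm_realMoebius_le_one {a : ℝ} (ha : |a| < 1) {z : ℂ} (hz : ‖z‖ ≤ 1) :
    ‖realMoebius a z‖ ≤ 1 := by
  have h0 := norm_pos_iff.2 (one_add_ofReal_mul_ne_zero ha hz)
  rw [realMoebius, norm_div, div_le_one h0]
  have h1 := normSq_one_add_sub_normSq_add a z
  have h2 : 0 ≤ (1 - a ^ 2) * (1 - ‖z‖ ^ 2) :=
    mul_nonneg (by nlinarith [(sq_lt_one_iff_abs_lt_one a).2 ha]) (by nlinarith [norm_nonneg z])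
  exact le_of_sq_le_sq (by linarith) h0.le

theorem norm_realMoebius_lt_one {a : ℝ} (ha : |a| < 1) {z : ℂ} (hz : ‖z‖ < 1) :
    ‖realMoebius a z‖ < 1 := by
  have h0 := norm_pos_iff.2 (one_add_ofReal_mul_ne_zero ha hz.le)
  rw [realMoebius, norm_div, div_lt_one h0]
  have h1 := normSq_one_add_sub_normSq_add a z
  have h2 : 0 < (1 - a ^ 2) * (1 - ‖z‖ ^ 2) :=
    mul_pos (by nlinarith [(sq_lt_one_iff_abs_lt_one a).2 ha]) (by nlinarith [norm_nonneg z])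
  exact lt_of_pow_lt_pow_left₀ 2 h0.le (by linarith)

theorem realMoebius_ofReal (a x : ℝ) :
    realMoebius a x = (((x + a) / (1 + a * x) : ℝ) : ℂ) := by
  simp [realMoebius]

theorem differentiableOn_comp_realMoebius {f : ℂ → ℂ} {a : ℝ} (ha : |a| < 1)
    (hf : DifferentiableOn ℂ f (ball 0 1)) :
    DifferentiableOn ℂ (fun z => f (realMoebius a z)) (ball 0 1) := by
  refine hf.comp (fun z hz => ?_) (fun z hz => ?_)
  · exact (differentiableAt_realMoebius ha (mem_ball_zero_iff.1 hz).le).differentiableWithinAt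
  · exact mem_ball_zero_iff.2 (norm_realMoebius_lt_one ha (mem_ball_zero_iff.1 hz))

theorem differentiableOn_realMoebius_comp {f : ℂ → ℂ} {a : ℝ} (ha : |a| < 1)
    (hf : DifferentiableOn ℂ f (ball 0 1)) (hb : ∀ z ∈ ball (0 : ℂ) 1, ‖f z‖ ≤ 1) :
    DifferentiableOn ℂ (fun z => realMoebius a (f z)) (ball 0 1) := fun z hz =>
  (differentiableAt_realMoebius ha (hb z hz)).comp_differentiableWithinAt z (hf z hz)

/-- The **Schwarz-Pick lemma** at the origin, for maps with a real value there. -/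
theorem norm_sub_le_norm_mul_of_apply_zero_real {f : ℂ → ℂ} {a : ℝ}
    (hf : DifferentiableOn ℂ f (ball 0 1)) (hb : ∀ z ∈ ball (0 : ℂ) 1, ‖f z‖ ≤ 1)
    (h0 : f 0 = a) {z : ℂ} (hz : ‖z‖ < 1) :
    ‖f z - a‖ ≤ ‖z‖ * ‖1 - a * f z‖ := by
  have hz' : z ∈ ball (0 : ℂ) 1 := mem_ball_zero_iff.2 hz
  have ha : |a| ≤ 1 := by simpa [h0] using hb 0 (by simp)
  rcases ha.lt_or_eq with ha | ha
  · have ha' : |-a| < 1 := by rwa [abs_neg]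
    have h1 : ‖realMoebius (-a) (f z)‖ ≤ ‖z‖ :=
      norm_le_norm_of_mapsTo_ball (f := fun z => realMoebius (-a) (f z))
        (differentiableOn_realMoebius_comp ha' hf hb)
        (fun w hw => mem_closedBall_zero_iff.2 (norm_realMoebius_le_one ha' (hb w hw)))
        (by simp [realMoebius, h0]) hz
    have h2 := norm_pos_iff.2 (one_add_ofReal_mul_ne_zero ha' (hb z hz'))
    rw [realMoebius, norm_div, div_le_iff₀ h2] at h1
    simpa [sub_eq_add_neg] using h1
  · have h1 : f z = f 0 := eqOn_of_isPreconnected_of_isMaxOn_norm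
      (convex_ball (0 : ℂ) 1).isPreconnected isOpen_ball hf (by simp)
      (fun w hw => by simpa [h0, ha] using hb w hw) hz'
    rw [h1, h0, sub_self, norm_zero]
    positivity

/-- The **Schwarz-Pick lemma** for the values of a map at two real points that are at
pseudohyperbolic distance `k`, when these values are real. -/
theorem mul_one_add_le_of_apply_real {f : ℂ → ℂ} {l k u v : ℝ}
    (hf : DifferentiableOn ℂ f (ball 0 1)) (hb : ∀ z ∈ ball (0 : ℂ) 1, ‖f z‖ ≤ 1)
    (hl : |l| < 1) (hk0 : 0 ≤ k) (hk1 : k < 1) (hu : f l = u)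
    (hv : f ((k + l) / (1 + l * k) : ℝ) = v) :
    v * (1 + k * u) ≤ k + u := by
  have hkn : ‖(k : ℂ)‖ < 1 := by simpa [abs_of_nonneg hk0]
  have hbl : ∀ z ∈ ball (0 : ℂ) 1, ‖f (realMoebius l z)‖ ≤ 1 := fun z hz =>
    hb _ (mem_ball_zero_iff.2 (norm_realMoebius_lt_one hl (mem_ball_zero_iff.1 hz)))
  have h := norm_sub_le_norm_mul_of_apply_zero_real (f := fun z => f (realMoebius l z)) (a := u)
    (differentiableOn_comp_realMoebius hl hf) hbl (by simp [realMoebius, hu]) hkn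
  have hu1 : |u| ≤ 1 := by simpa [realMoebius, hu] using hbl 0 (by simp)
  have hv1 : |v| ≤ 1 := by
    simpa only [realMoebius_ofReal, hv, norm_real, Real.norm_eq_abs] using
      hbl k (mem_ball_zero_iff.2 hkn)
  simp only [realMoebius_ofReal, hv] at h
  norm_cast at h
  have huv : 0 ≤ 1 - u * v := by
    have : |u * v| ≤ 1 := by
      rw [abs_mul]
      exact mul_le_one₀ hu1 (abs_nonneg _) hv1
    linarith [le_abs_self (u * v)]
  simp only [Real.norm_eq_abs, abs_of_nonneg hk0, abs_of_nonneg huv] at h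
  linarith [le_abs_self (v - u)]

theorem sub_div_one_sub_mul_le_iff {c x y : ℝ} (hc0 : 0 ≤ c) (hc1 : c < 1) (hx : x < 1)
    (hy : y < 1) : (x - c) / (1 - c * x) ≤ (y - c) / (1 - c * y) ↔ x ≤ y := by
  have hx' : 0 < 1 - c * x := by nlinarith
  have hy' : 0 < 1 - c * y := by nlinarith
  rw [div_le_div_iff₀ hx' hy']
  constructor <;> intro h <;> nlinarith [mul_pos (sub_pos.2 hc1) (by linarith : 0 < 1 + c)]

/-- Pushing `((l² - c) / (1 - c l²)) / l` along by the hyperbolic translation of parameter `k`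
stays below the same expression with `l` pushed along. -/
theorem add_div_one_add_mul_le {c l k b G : ℝ} (hc0 : 0 ≤ c) (hc1 : c < 1) (hl0 : 0 < l)
    (hl1 : l < 1) (hk0 : 0 ≤ k) (hk1 : k < 1) (hb : b = (k + l) / (1 + l * k))
    (hG : l * G = (l ^ 2 - c) / (1 - c * l ^ 2)) (hG1 : 0 < 1 + k * G) :
    b * ((k + G) / (1 + k * G)) ≤ (b ^ 2 - c) / (1 - c * b ^ 2) := by
  have ha : 0 < 1 + l * k := by positivity
  have hlc : 0 < 1 - c * l ^ 2 := by nlinarith [pow_lt_one₀ hl0.le hl1 two_ne_zero]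
  have hb0 : 0 ≤ b := by rw [hb]; positivity
  have hb1 : b < 1 := by rw [hb, div_lt_one ha]; nlinarith
  have hbc : 0 < 1 - c * b ^ 2 := by nlinarith [pow_lt_one₀ hb0 hb1 two_ne_zero]
  rw [eq_div_iff hlc.ne'] at hG
  rw [← mul_div_assoc, div_le_div_iff₀ hG1 hbc, ← sub_nonneg]
  have hP : ((b ^ 2 - c) * (1 + k * G) - b * (k + G) * (1 - c * b ^ 2)) *
      ((1 + l * k) ^ 3 * (l * (1 - c * l ^ 2))) =
      c * (1 + c) * k * (1 - k ^ 2) * (1 - l ^ 2) ^ 3 := by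
    have hGe : G = (l ^ 2 - c) / (l * (1 - c * l ^ 2)) := by
      rw [eq_div_iff (by positivity)]; linarith
    have hlc' : 1 - l ^ 2 * c ≠ 0 := mul_comm c _ ▸ hlc.ne'
    rw [hGe, hb]
    field_simp
    ring
  have hk2 : 0 ≤ 1 - k ^ 2 := by nlinarith
  have hl2 : 0 ≤ 1 - l ^ 2 := by nlinarith
  refine nonneg_of_mul_nonneg_left (b := (1 + l * k) ^ 3 * (l * (1 - c * l ^ 2))) ?_ (by positivity)
  rw [hP]
  positivity

/-- The bound when the parameter `l` is positive: the three points `-l`, `0` and `k` suffice. -/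
theorem re_apply_le_of_pos {h : ℂ → ℂ} {l k : ℝ} (hl0 : 0 < l) (hl1 : l < 1)
    (hhol : DifferentiableOn ℂ h (ball (0 : ℂ) 1))
    (hmaps : MapsTo h (ball (0 : ℂ) 1) (ball (0 : ℂ) 1))
    (hreal : ∀ x : ℝ, |x| < 1 → (h x).im = 0 ∧ 0 ≤ (h x).re ∧ (h x).re < 1)
    (h0 : (h 0).re ≤ l ^ 2) (hk0 : 0 ≤ k) (hk1 : k < 1) :
    (h k).re ≤ ((k + l) / (1 + k * l)) ^ 2 := by
  have hval : ∀ x : ℝ, |x| < 1 → h x = ((h x).re : ℂ) := fun x hx =>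
    Complex.ext (by simp) (by simp [(hreal x hx).1])
  have hla : |l| < 1 := by rwa [abs_of_pos hl0]
  have hla' : |-l| < 1 := by rwa [abs_neg]
  have hka : |k| < 1 := by rwa [abs_of_nonneg hk0]
  obtain ⟨-, hc0, hc1⟩ := hreal (-l) hla'
  have hcv := hval (-l) hla'
  obtain ⟨-, hs0, hs1⟩ := hreal 0 (by simp)
  have hsv := hval 0 (by simp)
  rw [ofReal_zero] at hs0 hs1 hsv
  obtain ⟨-, hH0, hH1⟩ := hreal k hka
  have hHv := hval k hka
  set c := (h (-l : ℝ)).re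
  set s := (h 0).re
  set H := (h k).re
  have hca : |-c| < 1 := by rwa [abs_neg, abs_of_nonneg hc0]
  set b := (k + l) / (1 + l * k) with hb
  have ha : 0 < 1 + l * k := by positivity
  have hb0 : 0 < b := by positivity
  have hb1 : b < 1 := by rw [hb, div_lt_one ha]; nlinarith
  have hba : |b| < 1 := by rwa [abs_of_pos hb0]
  have hl2 : l ^ 2 < 1 := pow_lt_one₀ hl0.le hl1 two_ne_zero
  have hb2 : b ^ 2 < 1 := pow_lt_one₀ hb0.le hb1 two_ne_zero
  rw [mul_comm k l, ← hb]
  let W : ℂ → ℂ := fun z => realMoebius (-c) (h (realMoebius (-l) z))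
  have hin : ∀ z ∈ ball (0 : ℂ) 1, ‖h (realMoebius (-l) z)‖ < 1 := fun z hz =>
    mem_ball_zero_iff.1 (hmaps (mem_ball_zero_iff.2
      (norm_realMoebius_lt_one hla' (mem_ball_zero_iff.1 hz))))
  have hWd : DifferentiableOn ℂ W (ball 0 1) :=
    differentiableOn_realMoebius_comp hca (differentiableOn_comp_realMoebius hla' hhol)
      fun z hz => (hin z hz).le
  have hW : ∀ x y v : ℝ, (x + -l) / (1 + -l * x) = y → h y = (v : ℂ) →
      W x = ((v - c) / (1 - c * v) : ℝ) := fun x y v hxy hv => by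
    simp only [W]
    rw [realMoebius_ofReal, hxy, hv, realMoebius_ofReal]
    congr 1
    ring
  have hW0 : W 0 = 0 := by
    have := hW 0 (-l) c (by simp) hcv
    simpa using this
  have hWl : W l = ((s - c) / (1 - c * s) : ℝ) := hW l 0 s (by simp) (by simpa using hsv)
  have hWb : W b = ((H - c) / (1 - c * H) : ℝ) := by
    refine hW b k H ?_ hHv
    have h1 : 1 + -l * b ≠ 0 := by nlinarith
    rw [div_eq_iff h1]
    have : b * (1 + l * k) = k + l := by rw [hb]; field_simp
    linear_combination this
  have hWm : MapsTo W (ball 0 1) (closedBall (W 0) 1) := fun z hz => by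
    rw [hW0]
    exact mem_closedBall_zero_iff.2 (norm_realMoebius_le_one hca (hin z hz).le)
  have hgd : DifferentiableOn ℂ (dslope W 0) (ball 0 1) :=
    (differentiableOn_dslope (ball_mem_nhds _ one_pos)).2 hWd
  have hgb : ∀ z ∈ ball (0 : ℂ) 1, ‖dslope W 0 z‖ ≤ 1 := fun z hz => by
    simpa using norm_dslope_le_div_of_mapsTo_ball hWd hWm hz
  have hgv : ∀ x v : ℝ, 0 < x → W x = v → dslope W 0 x = ((v / x : ℝ) : ℂ) := fun x v hx hv => by
    rw [dslope_of_ne _ (by exact_mod_cast hx.ne'), slope_def_field, hW0, hv]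
    simp
  set u := (s - c) / (1 - c * s) / l
  set v := (H - c) / (1 - c * H) / b
  have hu : dslope W 0 l = (u : ℂ) := hgv l _ hl0 hWl
  have hv : dslope W 0 b = (v : ℂ) := hgv b _ hb0 hWb
  have hu1 : |u| ≤ 1 := by simpa [hu] using hgb l (by simpa using hla)
  have hpick : v * (1 + k * u) ≤ k + u :=
    mul_one_add_le_of_apply_real hgd hgb hla hk0 hk1 hu hv
  set G := (l ^ 2 - c) / (1 - c * l ^ 2) / l with hG
  have huG : u ≤ G :=
    div_le_div_of_nonneg_right ((sub_div_one_sub_mul_le_iff hc0 hc1 hs1 hl2).2 h0) hl0.le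
  have hu' : 0 < 1 + k * u := by nlinarith [(abs_le.1 hu1).1]
  have hG' : 0 < 1 + k * G := by nlinarith
  have hmono : (k + u) / (1 + k * u) ≤ (k + G) / (1 + k * G) := by
    rw [div_le_div_iff₀ hu' hG']
    nlinarith [mul_nonneg (sub_nonneg.2 huG) (by nlinarith : 0 ≤ 1 - k ^ 2)]
  have hkey := add_div_one_add_mul_le hc0 hc1 hl0 hl1 hk0 hk1 hb
    (by rw [hG]; field_simp) hG'
  have hvle : v ≤ (k + G) / (1 + k * G) := ((le_div_iff₀ hu').2 hpick).trans hmono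
  have hfin : (H - c) / (1 - c * H) ≤ (b ^ 2 - c) / (1 - c * b ^ 2) :=
    calc (H - c) / (1 - c * H) = b * v := (mul_div_cancel₀ _ hb0.ne').symm
      _ ≤ b * ((k + G) / (1 + k * G)) := mul_le_mul_of_nonneg_left hvle hb0.le
      _ ≤ _ := hkey
  exact (sub_div_one_sub_mul_le_iff hc0 hc1 hH1 hb2).1 hfin

theorem blaschke_extremal_bound
    (h : ℂ → ℂ) (l : ℝ) (hl : l ∈ Set.Ico (0:ℝ) 1)
    (hhol : DifferentiableOn ℂ h (ball (0:ℂ) 1))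
    (hmaps : MapsTo h (ball (0:ℂ) 1) (ball (0:ℂ) 1))
    (hsym : ∀ z ∈ ball (0:ℂ) 1, h (starRingEnd ℂ z) = starRingEnd ℂ (h z))
    (hreal : ∀ x : ℝ, |x| < 1 → (h x).im = 0 ∧ 0 ≤ (h x).re ∧ (h x).re < 1)
    (h0 : (h 0).re ≤ l ^ 2) :
    ∀ k : ℝ, k ∈ Set.Ico (0:ℝ) 1 →
      (h k).re ≤ ((k + l) / (1 + k * l)) ^ 2 := by
  rintro k ⟨hk0, hk1⟩
  obtain ⟨hl0, hl1⟩ := hl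
  have hcont : ContinuousAt (fun t : ℝ => ((k + t) / (1 + k * t)) ^ 2) l := by
    have : 1 + k * l ≠ 0 := by positivity
    fun_prop (disch := assumption)
  refine ge_of_tendsto (hcont.tendsto.mono_left (nhdsWithin_le_nhds (s := Ioi l))) ?_
  filter_upwards [Ioo_mem_nhdsGT hl1] with t ⟨hlt, ht1⟩
  exact re_apply_le_of_pos (hl0.trans_lt hlt) ht1 hhol hmaps hreal
    (h0.trans (pow_le_pow_left₀ hl0 hlt.le 2)) hk0 hk1
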